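/- Assume the weight sequence b satisfies conditions (M1) and (M2). Then for every sufficiently large integer n the equation 𝒜_b(e^{−α}) = n has a unique solution α = α_n > 0; α_n → 0 as n → ∞, and it admits the asymptotic expansion α_n = a(n) + D(0)/((ρ+1)n) + O(n^{−1−β}), where β = min(C₀/(ρ+1), ρ/(ρ+1)), a(n) = (A Γ(ρ+1) ζ(ρ+1)/n)^{1/(ρ+1)}, and D(0) is the value at s = 0 of the analytic continuation of D. -/

import Mathlib

open Filter Topology Asymptotics MeasureTheory Real

noncomputable section

/-- `F_b(x) = -∑_{k≥1} b_k log(1 - x^k)` (so that `f_b = exp F_b`). -/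
def Fb (b : ℕ → ℝ) (x : ℝ) : ℝ := -∑' k : ℕ, b (k + 1) * Real.log (1 - x ^ (k + 1))

/-- Complex version of `log f_b` (principal branch). -/
def FbC (b : ℕ → ℝ) (x : ℂ) : ℂ := -∑' k : ℕ, (b (k + 1) : ℂ) * Complex.log (1 - x ^ (k + 1))

/-- `f_b(x) = ∏_{k≥1} (1 - x^k)^{-b_k}`. -/
def fb (b : ℕ → ℝ) (x : ℝ) : ℝ := Real.exp (Fb b x)

/-- Complex version of `f_b`. -/
def fbC (b : ℕ → ℝ) (x : ℂ) : ℂ := Complex.exp (FbC b x)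

/-- `F_{m,b}(x) = -∑_{k=1}^m b_k log(1 - x^k)`. -/
def Fmb (b : ℕ → ℝ) (m : ℕ) (x : ℝ) : ℝ := -∑ k ∈ Finset.Icc 1 m, b k * Real.log (1 - x ^ k)

/-- `f_{m,b}(x) = ∏_{k=1}^m (1 - x^k)^{-b_k}`. -/
def fmb (b : ℕ → ℝ) (m : ℕ) (x : ℝ) : ℝ := Real.exp (Fmb b m x)

/-- `𝒜_b(r) = r F_b'(r)`. -/
def Abf (b : ℕ → ℝ) (r : ℝ) : ℝ := r * deriv (Fb b) r

/-- `ℬ_b(r) = r² F_b''(r) + r F_b'(r)`. -/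
def Bbf (b : ℕ → ℝ) (r : ℝ) : ℝ :=
  r ^ 2 * iteratedDeriv 2 (Fb b) r + r * deriv (Fb b) r

/-- Meinardus condition (M1): the Dirichlet series `D(s) = ∑_{k≥1} b_k k^{-s}` converges for
`Re s > ρ` and `Dc` is its analytic continuation to `{Re s ≥ -C₀}`, analytic there except for a
simple pole at `s = ρ` with residue `A > 0`. -/
def M1 (b : ℕ → ℝ) (ρ C₀ A : ℝ) (Dc : ℂ → ℂ) : Prop :=
  0 < ρ ∧ 0 < C₀ ∧ C₀ < 1 ∧ 0 < A ∧
  (∀ s : ℂ, ρ < s.re →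
    HasSum (fun k : ℕ => (b (k + 1) : ℂ) * ((k + 1 : ℕ) : ℂ) ^ (-s)) (Dc s)) ∧
  (∀ s : ℂ, -C₀ ≤ s.re → s ≠ (ρ : ℂ) → DifferentiableAt ℂ Dc s) ∧
  (∃ φ : ℂ → ℂ, (∀ s : ℂ, -C₀ ≤ s.re → DifferentiableAt ℂ φ s) ∧
    ∀ s : ℂ, -C₀ ≤ s.re → s ≠ (ρ : ℂ) → Dc s = (A : ℂ) / (s - (ρ : ℂ)) + φ s)

/-- Meinardus condition (M2): the continuation `Dc` is of finite order `C₁` in `{Re s ≥ -C₀}`,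
i.e. `Dc s = O(|Im s|^{C₁})` as `|Im s| → ∞`, uniformly in `Re s ≥ -C₀`. -/
def M2 (C₀ C₁ : ℝ) (Dc : ℂ → ℂ) : Prop :=
  0 < C₁ ∧ ∃ K y₀ : ℝ, ∀ s : ℂ, -C₀ ≤ s.re → y₀ ≤ |s.im| → ‖Dc s‖ ≤ K * |s.im| ^ C₁

/-- Meinardus condition (M3): `∑_{k≥1} b_k e^{-kα} sin²(πku) ≥ C₂ α^{-ε}` for all small `α > 0`
and all `u` with `α/(2π) < |u| ≤ 1/2`. -/
def M3 (b : ℕ → ℝ) : Prop :=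
  ∃ ε C₂ : ℝ, 0 < ε ∧ 0 < C₂ ∧ ∃ α₀ : ℝ, 0 < α₀ ∧ ∀ α : ℝ, 0 < α → α ≤ α₀ →
    ∀ u : ℝ, α / (2 * π) < |u| → |u| ≤ 1 / 2 →
      C₂ * α ^ (-ε) ≤
        ∑' k : ℕ, b (k + 1) * Real.exp (-((k : ℝ) + 1) * α) * Real.sin (π * ((k : ℝ) + 1) * u) ^ 2

/-- `h = A Γ(ρ+1) ζ(ρ+1)`. -/
def hMein (ρ A : ℝ) : ℝ := A * Real.Gamma (ρ + 1) * (riemannZeta ((ρ : ℂ) + 1)).re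

/-- The normalizing constant `a(n) = (A Γ(ρ+1) ζ(ρ+1) / n)^{1/(ρ+1)}`. -/
def aM (ρ A : ℝ) (n : ℕ) : ℝ := (hMein ρ A / n) ^ ((1 : ℝ) / (ρ + 1))



lemma norm_Gamma_le_re {s : ℂ} (hs : 0 < s.re) : ‖Complex.Gamma s‖ ≤ Real.Gamma s.re := by
  rw [Complex.Gamma_eq_integral hs, Real.Gamma_eq_integral hs, Complex.GammaIntegral]
  refine (norm_integral_le_integral_norm _).trans (le_of_eq ?_)
  refine setIntegral_congr_fun measurableSet_Ioi (fun t ht => ?_)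
  have ht' : (0:ℝ) < t := ht
  simp only [norm_mul]
  rw [Complex.norm_cpow_eq_rpow_re_of_pos ht']
  simp [Complex.norm_exp]

lemma Gamma_decay (M : ℕ) : ∀ c d : ℝ, 0 < c → ∃ K : ℝ, 0 ≤ K ∧ ∀ s : ℂ, c ≤ s.re → s.re ≤ d →
    1 ≤ |s.im| → ‖Complex.Gamma s‖ ≤ K / |s.im| ^ M := by
  induction M with
  | zero =>
    intro c d hc
    have hcont : ContinuousOn Real.Gamma (Set.Icc c d) := by
      intro x hx
      have hx0 : 0 < x := lt_of_lt_of_le hc hx.1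
      refine (Real.differentiableAt_Gamma (fun m => ?_)).continuousAt.continuousWithinAt
      have : (0:ℝ) ≤ m := Nat.cast_nonneg m
      linarith
    obtain ⟨K, hK⟩ := isCompact_Icc.exists_bound_of_continuousOn hcont
    refine ⟨max K 0, le_max_right _ _, fun s h1 h2 _ => ?_⟩
    have := hK s.re ⟨h1, h2⟩
    rw [pow_zero, div_one]
    exact (norm_Gamma_le_re (lt_of_lt_of_le hc h1)).trans
      ((le_abs_self _).trans (this.trans (le_max_left _ _)))
  | succ M ih =>
    intro c d hc
    obtain ⟨K, hK0, hK⟩ := ih (c+1) (d+1) (by linarith)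
    refine ⟨K, hK0, fun s h1 h2 h3 => ?_⟩
    have hs0 : s ≠ 0 := by
      rintro rfl
      simp at h3
      linarith
    have h := hK (s+1) (by simpa using h1) (by simpa using h2) (by simpa using h3)
    rw [Complex.Gamma_add_one s hs0, norm_mul] at h
    simp only [Complex.add_im, Complex.one_im, add_zero] at h
    have hpos : 0 < |s.im| := by linarith
    have h4 : |s.im| * ‖Complex.Gamma s‖ ≤ K / |s.im| ^ M :=
      (mul_le_mul_of_nonneg_right (Complex.abs_im_le_norm s) (norm_nonneg _)).trans h
    rw [pow_succ, ← div_div, le_div_iff₀ hpos]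
    linarith

lemma Lambda0_bound (c d : ℝ) : ∃ K : ℝ, 0 ≤ K ∧ ∀ s : ℂ, c ≤ s.re → s.re ≤ d →
    ‖completedRiemannZeta₀ s‖ ≤ K := by
  set P := HurwitzZeta.hurwitzEvenFEPair 0 with hP
  have hconv : ∀ s : ℂ, MellinConvergent P.f_modif s := fun s =>
    (P.isStrongFEPair_toStrongFEPair.hasMellin s).1
  have hintg : ∀ r : ℝ, IntegrableOn (fun t : ℝ => t ^ (r - 1) * ‖P.f_modif t‖) (Set.Ioi 0) := by
    intro r
    refine IntegrableOn.congr_fun (Integrable.norm (hconv r)) (fun t ht => ?_) measurableSet_Ioi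
    have ht' : (0:ℝ) < t := ht
    simp only [norm_smul]
    rw [Complex.norm_cpow_eq_rpow_re_of_pos ht']
    simp
  set J : ℝ := ∫ t in Set.Ioi (0:ℝ), (t ^ (c/2 - 1) * ‖P.f_modif t‖ + t ^ (d/2 - 1) * ‖P.f_modif t‖) with hJ
  have hJ0 : 0 ≤ J := by
    refine setIntegral_nonneg measurableSet_Ioi (fun t ht => ?_)
    have ht' : (0:ℝ) < t := ht
    positivity
  refine ⟨J / 2, by positivity, fun s h1 h2 => ?_⟩
  have : completedRiemannZeta₀ s = mellin P.f_modif (s/2) / 2 := rfl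
  rw [this, norm_div, Complex.norm_ofNat]
  gcongr
  rw [mellin]
  refine norm_integral_le_of_norm_le ((hintg (c/2)).add (hintg (d/2))) ?_
  refine (ae_restrict_iff' measurableSet_Ioi).2 (Eventually.of_forall fun t ht => ?_)
  have ht' : (0:ℝ) < t := ht
  rw [norm_smul, Complex.norm_cpow_eq_rpow_re_of_pos ht']
  have e : (s/2 - 1).re = s.re/2 - 1 := by simp
  rw [e]
  rw [← add_mul]
  gcongr
  rcases le_total 1 t with h | h
  · have := Real.rpow_le_rpow_of_exponent_le h (show s.re/2-1 ≤ d/2-1 by linarith)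
    have := Real.rpow_nonneg ht'.le (c/2-1)
    linarith
  · have := Real.rpow_le_rpow_of_exponent_ge ht' h (show c/2-1 ≤ s.re/2-1 by linarith)
    have := Real.rpow_nonneg ht'.le (d/2-1)
    linarith

/-- `P(s) = (s-1) Γ(s) ζ(s)`, in a form analytic for `Re s > 0`. -/
def PP (s : ℂ) : ℂ :=
  (2:ℂ) ^ (s - 1) * (π:ℂ) ^ ((s - 1) / 2) * Complex.Gamma ((s + 1) / 2) *
    ((s - 1) * completedRiemannZeta₀ s - (s - 1) / s + 1)

lemma PP_eq {s : ℂ} (hs : 0 < s.re) (hs1 : s ≠ 1) :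
    PP s = (s - 1) * (Complex.Gamma s * riemannZeta s) := by
  have hs0 : s ≠ 0 := by rintro rfl; simp at hs
  have hs1' : s - 1 ≠ 0 := sub_ne_zero.2 hs1
  have hs1'' : 1 - s ≠ 0 := sub_ne_zero.2 (Ne.symm hs1)
  have hG : Complex.Gamma (s/2) ≠ 0 := Complex.Gamma_ne_zero_of_re_pos (by simpa using hs)
  have dup := Complex.Gamma_mul_Gamma_add_half (s/2)
  rw [show 2 * (s/2) = s by ring, show s/2 + 1/2 = (s+1)/2 by ring] at dup
  rw [riemannZeta_def_of_ne_zero hs0, Complex.Gammaℝ_def, completedRiemannZeta_eq, PP]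
  have hpi : (π:ℂ) ≠ 0 := by exact_mod_cast Real.pi_ne_zero
  have hsq : ((√π : ℝ) : ℂ) = (π:ℂ) ^ (1/2 : ℂ) := by
    rw [Real.sqrt_eq_rpow, Complex.ofReal_cpow Real.pi_pos.le]; norm_num
  have e1 : (π:ℂ) ^ (-s/2) * (π:ℂ) ^ ((s-1)/2) * (π:ℂ) ^ (1/2:ℂ) = 1 := by
    rw [← Complex.cpow_add _ _ hpi, ← Complex.cpow_add _ _ hpi]
    rw [show -s/2 + (s-1)/2 + 1/2 = 0 by ring, Complex.cpow_zero]
  have e2 : (2:ℂ) ^ (s-1) * (2:ℂ) ^ (1-s) = 1 := by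
    rw [← Complex.cpow_add _ _ two_ne_zero, show s - 1 + (1 - s) = 0 by ring, Complex.cpow_zero]
  have hpp : (π:ℂ) ^ (-s/2) ≠ 0 := by simp [Complex.cpow_eq_zero_iff, hpi]
  have hbr : (s - 1) * completedRiemannZeta₀ s - (s - 1) / s + 1 =
      (s-1) * (completedRiemannZeta₀ s - 1 / s - 1 / (1 - s)) := by
    field_simp
    ring
  rw [hbr]
  rw [mul_div_assoc', mul_div_assoc', eq_div_iff (mul_ne_zero hpp hG)]
  rw [hsq] at dup
  set X := completedRiemannZeta₀ s - 1 / s - 1 / (1 - s)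
  calc _ = (s-1) * X * ((2:ℂ) ^ (s-1)) * ((π:ℂ) ^ (-s/2) * (π:ℂ) ^ ((s-1)/2)) *
        (Complex.Gamma (s/2) * Complex.Gamma ((s+1)/2)) := by ring
    _ = (s-1) * X * Complex.Gamma s * ((2:ℂ) ^ (s-1) * (2:ℂ) ^ (1-s)) * ((π:ℂ) ^ (-s/2) * (π:ℂ) ^ ((s-1)/2) * (π:ℂ) ^ (1/2:ℂ)) := by
        rw [dup]; ring
    _ = _ := by rw [e1, e2]; ring

lemma PP_one : PP 1 = 1 := by simp [PP]

lemma PP_diff {s : ℂ} (hs : 0 < s.re) : DifferentiableAt ℂ PP s := by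
  have hs0 : s ≠ 0 := by rintro rfl; simp at hs
  have hpi : (π:ℂ) ≠ 0 := by exact_mod_cast Real.pi_ne_zero
  have hG : DifferentiableAt ℂ (fun s : ℂ => Complex.Gamma ((s+1)/2)) s := by
    have : DifferentiableAt ℂ Complex.Gamma ((s+1)/2) := by
      refine Complex.differentiableAt_Gamma _ (fun m h => ?_)
      have := congrArg Complex.re h
      simp at this
      have : (0:ℝ) ≤ m := Nat.cast_nonneg m
      linarith
    exact DifferentiableAt.comp (f := fun s : ℂ => (s+1)/2) s this (by fun_prop)
  have hL := differentiable_completedZeta₀ s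
  have h2 : DifferentiableAt ℂ (fun s : ℂ => (2:ℂ) ^ (s-1)) s :=
    DifferentiableAt.const_cpow (by fun_prop) (Or.inl two_ne_zero)
  have h3 : DifferentiableAt ℂ (fun s : ℂ => (π:ℂ) ^ ((s-1)/2)) s :=
    DifferentiableAt.const_cpow (by fun_prop) (Or.inl hpi)
  unfold PP
  refine ((h2.mul h3).mul hG).mul ?_
  have h4 : DifferentiableAt ℂ (fun s : ℂ => (s-1)/s) s := by fun_prop (disch := exact hs0)
  exact (((by fun_prop : DifferentiableAt ℂ (fun s : ℂ => s - 1) s).mul hL).sub h4).add_const _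

lemma PP_div_bound (M : ℕ) (c d : ℝ) (hc : 0 < c) : ∃ K : ℝ, 0 ≤ K ∧ ∀ s : ℂ, c ≤ s.re →
    s.re ≤ d → 2 ≤ |s.im| → ‖PP s / (s - 1)‖ ≤ K / |s.im| ^ M := by
  obtain ⟨K1, hK1, hG⟩ := Gamma_decay M ((c+1)/2) ((d+1)/2) (by linarith)
  obtain ⟨K2, hK2, hL⟩ := Lambda0_bound c d
  refine ⟨(2:ℝ) ^ (d-1) * π ^ ((d-1)/2) * (K1 * 2 ^ M) * (K2 + 2), by positivity,
    fun s h1 h2 h3 => ?_⟩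
  have hs0 : s ≠ 0 := by rintro rfl; simp at h3; linarith
  have hs1 : s - 1 ≠ 0 := by
    intro h
    have := congrArg Complex.im h
    simp at this
    rw [this] at h3; simp at h3; linarith
  have hbr : PP s / (s-1) = (2:ℂ) ^ (s - 1) * (π:ℂ) ^ ((s - 1) / 2) * Complex.Gamma ((s + 1) / 2) *
    (completedRiemannZeta₀ s - 1 / s + 1/(s-1)) := by
    rw [PP]; field_simp
  rw [hbr, norm_mul, norm_mul, norm_mul]
  have e2 : ‖(2:ℂ) ^ (s-1)‖ ≤ (2:ℝ) ^ (d-1) := by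
    have := Complex.norm_cpow_eq_rpow_re_of_pos (show (0:ℝ) < 2 by norm_num) (s-1)
    rw [Complex.ofReal_ofNat] at this
    rw [this]
    apply Real.rpow_le_rpow_of_exponent_le (by norm_num)
    simpa using h2
  have e3 : ‖(π:ℂ) ^ ((s-1)/2)‖ ≤ π ^ ((d-1)/2) := by
    rw [Complex.norm_cpow_eq_rpow_re_of_pos Real.pi_pos]
    apply Real.rpow_le_rpow_of_exponent_le (by linarith [Real.pi_gt_three])
    simp
    linarith
  have him : |((s+1)/2).im| = |s.im| / 2 := by simp [abs_div]
  have e4 : ‖Complex.Gamma ((s+1)/2)‖ ≤ K1 * 2 ^ M / |s.im| ^ M := by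
    have := hG ((s+1)/2) (by simp; linarith) (by simp; linarith) (by rw [him]; linarith)
    rw [him, div_pow, div_div_eq_mul_div] at this
    exact this
  have i0 : 1 ≤ ‖s‖ := by linarith [Complex.abs_im_le_norm s]
  have i1 : 1 ≤ ‖s - 1‖ := by
    have := Complex.abs_im_le_norm (s-1)
    simp at this
    linarith
  have e5 : ‖completedRiemannZeta₀ s - 1 / s + 1/(s-1)‖ ≤ K2 + 2 := by
    have a1 : ‖1/s‖ ≤ 1 := by
      rw [norm_div, norm_one]; exact div_le_one_of_le₀ i0 (norm_nonneg _)
    have a2 : ‖1/(s-1)‖ ≤ 1 := by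
      rw [norm_div, norm_one]; exact div_le_one_of_le₀ i1 (norm_nonneg _)
    have := norm_add_le (completedRiemannZeta₀ s - 1 / s) (1/(s-1))
    have := norm_sub_le (completedRiemannZeta₀ s) (1 / s)
    linarith [hL s h1 h2]
  calc _ ≤ (2:ℝ) ^ (d-1) * π ^ ((d-1)/2) * (K1 * 2 ^ M / |s.im| ^ M) * (K2 + 2) := by gcongr
    _ = _ := by ring



lemma vert_integrable (G : ℂ → ℂ) (S : Set ℂ) (a K : ℝ) (hS : ∀ t : ℝ, (a + t * Complex.I : ℂ) ∈ S)
    (hG : ContinuousOn G S)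
    (hb : ∀ s ∈ S, ‖G s‖ ≤ K / (1 + s.im ^ 2)) :
    Integrable (fun t : ℝ => G (a + t * Complex.I)) := by
  have hcont : Continuous (fun t : ℝ => G (a + t * Complex.I)) :=
    hG.comp_continuous (by fun_prop) hS
  have hI : Integrable (fun t : ℝ => K * (1 + t ^ 2)⁻¹) := integrable_inv_one_add_sq.const_mul K
  refine hI.mono' hcont.aestronglyMeasurable (Eventually.of_forall fun t => ?_)
  have := hb _ (hS t)
  simpa [div_eq_mul_inv] using this

lemma contour_shift (G : ℂ → ℂ) (c d K : ℝ) (hcd : c ≤ d)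
    (hG : DifferentiableOn ℂ G {s : ℂ | c ≤ s.re ∧ s.re ≤ d})
    (hb : ∀ s ∈ {s : ℂ | c ≤ s.re ∧ s.re ≤ d}, ‖G s‖ ≤ K / (1 + s.im ^ 2)) :
    ∫ t : ℝ, G (d + t * Complex.I) = ∫ t : ℝ, G (c + t * Complex.I) := by
  have hc := vert_integrable G _ c K (fun t => by simp [hcd]) hG.continuousOn hb
  have hd := vert_integrable G _ d K (fun t => by simp [hcd]) hG.continuousOn hb
  have l1 := intervalIntegral_tendsto_integral hc tendsto_neg_atTop_atBot tendsto_id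
  have l2 := intervalIntegral_tendsto_integral hd tendsto_neg_atTop_atBot tendsto_id
  have hT : Tendsto (fun T : ℝ => K / (1 + T ^ 2) * |d - c|) atTop (𝓝 0) := by
    rw [← zero_mul |d - c|]
    refine Tendsto.mul_const _ (Tendsto.div_atTop tendsto_const_nhds ?_)
    exact tendsto_atTop_add_const_left _ _ (tendsto_pow_atTop two_ne_zero)
  have hor : ∀ e : ℝ → ℝ, (∀ T, (e T) ^ 2 = T ^ 2) → Tendsto (fun T : ℝ => ∫ x in c..d, G (x + (e T : ℝ) * Complex.I)) atTop (𝓝 0) := by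
    intro e he
    refine squeeze_zero_norm (fun T => ?_) hT
    refine intervalIntegral.norm_integral_le_of_norm_le_const (fun x hx => ?_)
    rw [Set.uIoc_of_le hcd] at hx
    have := hb (x + (e T : ℝ) * Complex.I) (by simp; exact ⟨hx.1.le, hx.2⟩)
    simpa [he] using this
  have h1 := hor (fun T => -T) (by simp)
  have h2 := hor (fun T => T) (by simp)
  have rect : ∀ T : ℝ, (∫ x in c..d, G (x + (-T : ℝ) * Complex.I)) - (∫ x in c..d, G (x + (T : ℝ) * Complex.I))
      + Complex.I • (∫ t in (-T)..T, G (d + t * Complex.I)) - Complex.I • (∫ t in (-T)..T, G (c + t * Complex.I)) = 0 := by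
    intro T
    have := Complex.integral_boundary_rect_eq_zero_of_differentiableOn G (c + (-T:ℝ) * Complex.I) (d + T * Complex.I) (by
      refine hG.mono (fun s hs => ?_)
      rw [Complex.mem_reProdIm] at hs
      have := hs.1
      simp [Set.uIcc_of_le hcd] at this
      exact this)
    simpa using this
  have lim := ((h1.sub h2).add (l2.const_smul Complex.I)).sub (l1.const_smul Complex.I)
  have lim0 := tendsto_nhds_unique lim ((tendsto_const_nhds (x := (0:ℂ))).congr (fun T => (rect T).symm))
  simp only [sub_zero, zero_add, smul_eq_mul] at lim0
  rw [← mul_sub] at lim0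
  have := (mul_eq_zero.1 lim0).resolve_left Complex.I_ne_zero
  exact sub_eq_zero.1 this

lemma key_H (W : ℂ → ℂ) (c d p : ℝ) (hc : 0 < c) (hc1 : c < 1) (hp : 1 < p)
    (hW : DifferentiableOn ℂ W {s | c ≤ s.re})
    (hbd : ∃ K T : ℝ, 0 ≤ K ∧ ∀ s : ℂ, c ≤ s.re → s.re ≤ d → T ≤ |s.im| →
      ‖W s / ((s - 1) * (s - p))‖ ≤ K / |s.im| ^ 2) :
    ∃ H : ℂ → ℂ, DifferentiableOn ℂ H {s : ℂ | c ≤ s.re ∧ s.re ≤ d} ∧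
      (∃ K : ℝ, 0 ≤ K ∧ ∀ s ∈ {s : ℂ | c ≤ s.re ∧ s.re ≤ d}, ‖H s‖ ≤ K / (1 + s.im ^ 2)) ∧
      ∀ s : ℂ, s ≠ 1 → s ≠ p → s ≠ 0 → H s = W s / ((s - 1) * (s - p))
        - W p / (p - 1) * (1 / (s - p) - 1 / s) - W 1 / (1 - p) * (1 / (s - 1) - 1 / s) := by
  have hp1 : (p:ℂ) - 1 ≠ 0 := by
    rw [sub_ne_zero]; exact_mod_cast hp.ne'
  have hp1' : (p:ℂ) ≠ 1 := by exact_mod_cast hp.ne'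
  have hp1'' : 1 - (p:ℂ) ≠ 0 := by
    rw [sub_ne_zero]; exact_mod_cast hp.ne
  have hnhds : ∀ q : ℝ, 1 ≤ q → {s : ℂ | c ≤ s.re} ∈ 𝓝 (q:ℂ) := by
    intro q hq
    refine mem_of_superset ((isOpen_lt continuous_const Complex.continuous_re).mem_nhds (?_ : (q:ℂ) ∈ {s : ℂ | c < s.re})) (fun s (hs : c < s.re) => hs.le)
    simp; linarith
  set W1 := dslope W 1 with hW1
  set W2 := dslope W1 p with hW2
  have dW1 : DifferentiableOn ℂ W1 {s | c ≤ s.re} :=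
    (Complex.differentiableOn_dslope (by simpa using hnhds 1 le_rfl)).2 hW
  have dW2 : DifferentiableOn ℂ W2 {s | c ≤ s.re} :=
    (Complex.differentiableOn_dslope (hnhds p hp.le)).2 dW1
  set H : ℂ → ℂ := fun s => W2 s + (W p / (p - 1) + W 1 / (1 - p)) / s with hH
  have dH : DifferentiableOn ℂ H {s : ℂ | c ≤ s.re ∧ s.re ≤ d} := by
    refine (dW2.mono (fun s hs => hs.1)).add ?_
    refine DifferentiableOn.div (differentiableOn_const _) differentiableOn_id (fun s hs => ?_)
    intro h
    have := hs.1
    rw [h] at this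
    simp at this
    linarith
  have eqH : ∀ s : ℂ, s ≠ 1 → s ≠ p → s ≠ 0 → H s = W s / ((s - 1) * (s - p))
        - W p / (p - 1) * (1 / (s - p) - 1 / s) - W 1 / (1 - p) * (1 / (s - 1) - 1 / s) := by
    intro s h1 h2 h3
    have h1' := sub_ne_zero.2 h1
    have h2' := sub_ne_zero.2 h2
    simp only [hH, hW2, hW1]
    rw [dslope_of_ne _ h2, slope_def_field, dslope_of_ne _ h1, slope_def_field, dslope_of_ne _ hp1', slope_def_field]
    rw [show (1 - (p:ℂ)) = -(p - 1) by ring]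
    field_simp
    ring
  refine ⟨H, dH, ?_, eqH⟩
  obtain ⟨K, T, hK, hbd⟩ := hbd
  set T' := max T 1
  obtain ⟨K0, hK0⟩ := ((isCompact_Icc (a := c) (b := d)).reProdIm (isCompact_Icc (a := -T') (b := T'))).exists_bound_of_continuousOn
    (dH.continuousOn.mono (fun s hs => by rw [Complex.mem_reProdIm] at hs; exact hs.1))
  set L := K + ‖W p / (p-1)‖ * p + ‖W 1 / (1-p)‖ with hL
  have hL0 : 0 ≤ L := by positivity
  refine ⟨max (2 * L) (|K0| * (1 + T' ^ 2)), by positivity, fun s hs => ?_⟩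
  have hpos : 0 < 1 + s.im ^ 2 := by positivity
  rw [le_div_iff₀ hpos]
  rcases le_total T' |s.im| with h | h
  · refine le_trans ?_ (le_max_left _ _)
    have him1 : 1 ≤ |s.im| := (le_max_right _ _).trans h
    have him0 : s.im ≠ 0 := by intro h0; rw [h0] at him1; simp at him1; linarith
    have hne : ∀ q : ℝ, |s.im| ≤ ‖s - q‖ := by
      intro q
      simpa using Complex.abs_im_le_norm (s - q)
    have hne' : ∀ q : ℝ, s - q ≠ 0 := by
      intro q; rw [← norm_pos_iff]; linarith [hne q]
    have z1 : s - 1 ≠ 0 := by simpa using hne' 1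
    have z0 : s ≠ 0 := by simpa using hne' 0
    have zp := hne' p
    have n1 : |s.im| ≤ ‖s - 1‖ := by simpa using hne 1
    have n0 : |s.im| ≤ ‖s‖ := by simpa using hne 0
    rw [eqH s (sub_ne_zero.1 z1) (sub_ne_zero.1 zp) z0]
    have b1 := hbd s hs.1 hs.2 ((le_max_left _ _).trans h)
    have b2 : ‖1 / (s - p) - 1 / s‖ ≤ p / |s.im| ^ 2 := by
      rw [div_sub_div _ _ zp z0, norm_div, norm_mul, show 1 * s - (s - p) * 1 = (p:ℂ) by ring, Complex.norm_real, Real.norm_of_nonneg (by linarith), pow_two]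
      have := hne p
      gcongr
    have b3 : ‖1 / (s - 1) - 1 / s‖ ≤ 1 / |s.im| ^ 2 := by
      rw [div_sub_div _ _ z1 z0, norm_div, norm_mul, show 1 * s - (s - 1) * 1 = (1:ℂ) by ring, norm_one, pow_two]
      gcongr
    have tot : ‖W s / ((s - 1) * (s - p))
        - W p / (p - 1) * (1 / (s - p) - 1 / s) - W 1 / (1 - p) * (1 / (s - 1) - 1 / s)‖ ≤ L / |s.im| ^ 2 := by
      refine (norm_sub_le _ _).trans ?_
      refine (add_le_add (norm_sub_le _ _) le_rfl).trans ?_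
      rw [norm_mul, norm_mul]
      calc _ ≤ K / |s.im| ^ 2 + ‖W p / (p-1)‖ * (p / |s.im| ^ 2) + ‖W 1 / (1-p)‖ * (1 / |s.im| ^ 2) := by gcongr
        _ = _ := by rw [hL]; ring
    rw [sq_abs] at tot
    have hsq : 1 ≤ s.im ^ 2 := by rw [← sq_abs]; nlinarith
    calc _ ≤ L / s.im ^ 2 * (1 + s.im ^ 2) := by gcongr
      _ ≤ L / s.im ^ 2 * (2 * s.im ^ 2) := by gcongr; linarith
      _ = 2 * L := by field_simp
  · refine le_trans ?_ (le_max_right _ _)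
    have := hK0 s (by rw [Complex.mem_reProdIm]; exact ⟨hs, abs_le.1 h⟩)
    have h2 : s.im ^ 2 ≤ T' ^ 2 := by rw [← sq_abs]; gcongr
    have : ‖H s‖ ≤ |K0| := this.trans (le_abs_self _)
    gcongr

lemma asymp (f : ℝ → ℂ) (W : ℂ → ℂ) (c d p : ℝ) (hc : 0 < c) (hc1 : c < 1) (hp : 1 < p) (hpd : p < d)
    (hW : DifferentiableOn ℂ W {s | c ≤ s.re})
    (hbd : ∃ K T : ℝ, 0 ≤ K ∧ ∀ s : ℂ, c ≤ s.re → s.re ≤ d → T ≤ |s.im| →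
      ‖W s / ((s - 1) * (s - p))‖ ≤ K / |s.im| ^ 2)
    (hf : ∀ s : ℂ, s.re = d → HasMellin f s (W s / ((s - 1) * (s - p))))
    (hfc : ∀ x, 0 < x → ContinuousAt f x) :
    ∃ K : ℝ, ∀ x : ℝ, 0 < x → x < 1 →
      ‖f x - W p / (p - 1) * ((x ^ (-p) : ℝ) : ℂ) - W 1 / (1 - p) * ((x ^ (-1:ℝ) : ℝ) : ℂ)‖ ≤ K * x ^ (-c) := by
  obtain ⟨H, dH, ⟨K, hK0, hK⟩, eqH⟩ := key_H W c d p hc hc1 hp hW hbd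
  set h := W p / (p - 1) with hh
  set D0 := W 1 / (1 - p) with hD0
  let I0 : ℝ → ℂ := Set.indicator (Set.Ioc 0 1) (fun t => (t:ℂ) ^ (0:ℂ))
  let Ip : ℝ → ℂ := Set.indicator (Set.Ioc 0 1) (fun t => (t:ℂ) ^ (-p:ℂ))
  let I1 : ℝ → ℂ := Set.indicator (Set.Ioc 0 1) (fun t => (t:ℂ) ^ (-1:ℂ))
  let q : ℝ → ℂ := fun t => f t - h • (Ip t - I0 t) - D0 • (I1 t - I0 t)
  have hq : ∀ s : ℂ, s.re = d → HasMellin q s (H s) := by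
    intro s hs
    have hre : ∀ r : ℝ, r < d → s ≠ r := by
      intro r hr h; rw [h] at hs; simp at hs; linarith
    have m0 := hasMellin_cpow_Ioc (0:ℂ) (s := s) (by simp; linarith)
    have mp := hasMellin_cpow_Ioc (-p:ℂ) (s := s) (by simp; linarith)
    have m1 := hasMellin_cpow_Ioc (-1:ℂ) (s := s) (by simp; linarith)
    have a1 := hasMellin_sub mp.1 m0.1
    have a2 := hasMellin_sub m1.1 m0.1
    have a3 := hasMellin_const_smul a1.1 h
    have a4 := hasMellin_const_smul a2.1 D0
    have a5 := hasMellin_sub (hf s hs).1 a3.1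
    have a6 := hasMellin_sub a5.1 a4.1
    refine ⟨a6.1, ?_⟩
    refine a6.2.trans ?_
    rw [a5.2, a4.2, a3.2, a2.2, a1.2, m0.2, mp.2, m1.2, (hf s hs).2]
    rw [eqH s (by simpa using hre 1 (by linarith)) (hre p hpd) (by simpa using hre 0 (by linarith))]
    simp only [smul_eq_mul, add_zero, ← sub_eq_add_neg]
  refine ⟨K / 2 + ‖h‖ + ‖D0‖, fun x hx0 hx1 => ?_⟩
  have hxC : (x:ℂ) ≠ 0 := by exact_mod_cast hx0.ne'
  have hqc : ContinuousAt q x := by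
    have hind : ∀ a : ℂ, ContinuousAt (Set.indicator (Set.Ioc (0:ℝ) 1) (fun t : ℝ => (t:ℂ) ^ a)) x := by
      intro a
      have e : (fun t : ℝ => (t:ℂ) ^ a) =ᶠ[𝓝 x] Set.indicator (Set.Ioc (0:ℝ) 1) (fun t : ℝ => (t:ℂ) ^ a) := by
        filter_upwards [Ioo_mem_nhds hx0 hx1] with t ht
        have ht' : t ∈ Set.Ioc (0:ℝ) 1 := ⟨ht.1, ht.2.le⟩
        rw [Set.indicator_of_mem ht']
      refine ContinuousAt.congr ?_ e
      exact Complex.continuousAt_ofReal_cpow_const x a (Or.inr hx0.ne')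
    have c0 := hind 0
    have cp := hind (-p)
    have c1 := hind (-1)
    exact (((hfc x hx0).sub ((cp.sub c0).const_smul h)).sub ((c1.sub c0).const_smul D0))
  have hmel : ∀ t : ℝ, mellin q (d + t * Complex.I) = H (d + t * Complex.I) := fun t =>
    (hq _ (by simp)).2
  have hvert : Complex.VerticalIntegrable (mellin q) d := by
    unfold Complex.VerticalIntegrable
    simp_rw [hmel]
    exact vert_integrable H _ d K (fun t => by simp; linarith) dH.continuousOn hK
  have inv := mellinInv_mellin_eq d q hx0 (hq d (by simp)).1 hvert hqc
  rw [mellinInv] at inv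
  simp_rw [hmel] at inv
  set G : ℂ → ℂ := fun s => (x:ℂ) ^ (-s) * H s with hG
  have dG : DifferentiableOn ℂ G {s : ℂ | c ≤ s.re ∧ s.re ≤ d} := by
    refine DifferentiableOn.mul ?_ dH
    intro s _
    exact (DifferentiableAt.const_cpow (by fun_prop) (Or.inl hxC)).differentiableWithinAt
  have nG : ∀ s, ‖G s‖ = x ^ (-s.re) * ‖H s‖ := by
    intro s
    rw [hG]; simp only [norm_mul]; rw [Complex.norm_cpow_eq_rpow_re_of_pos hx0]; simp
  have bG : ∀ s ∈ {s : ℂ | c ≤ s.re ∧ s.re ≤ d}, ‖G s‖ ≤ (x ^ (-d) * K) / (1 + s.im ^ 2) := by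
    intro s hs
    rw [nG, mul_div_assoc]
    have := hK s hs
    have : x ^ (-s.re) ≤ x ^ (-d) := Real.rpow_le_rpow_of_exponent_ge hx0 hx1.le (by linarith [hs.2])
    gcongr
  have sh := contour_shift G c d _ (by linarith) dG bG
  have inv' : (1 / (2 * π) : ℝ) * ∫ t : ℝ, G (d + t * Complex.I) = q x := by
    rw [← inv]
    simp [hG]
  rw [sh] at inv'
  have nq : ‖q x‖ ≤ K / 2 * x ^ (-c) := by
    rw [← inv', norm_mul, Complex.norm_real, Real.norm_of_nonneg (by positivity)]
    have : ‖∫ t : ℝ, G (c + t * Complex.I)‖ ≤ ∫ t : ℝ, (x ^ (-c) * K) * (1 + t ^ 2)⁻¹ := by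
      refine norm_integral_le_of_norm_le (integrable_inv_one_add_sq.const_mul _) (Eventually.of_forall fun t => ?_)
      rw [nG]
      have := hK (c + t * Complex.I) (by simp; linarith)
      simp [div_eq_mul_inv] at this ⊢
      rw [mul_assoc]
      gcongr
    rw [integral_const_mul, integral_univ_inv_one_add_sq] at this
    calc _ ≤ 1 / (2 * π) * (x ^ (-c) * K * π) := by gcongr
      _ = _ := by field_simp
  have mem : x ∈ Set.Ioc (0:ℝ) 1 := ⟨hx0, hx1.le⟩
  have qx : f x - h * ((x ^ (-p) : ℝ) : ℂ) - D0 * ((x ^ (-1:ℝ) : ℝ) : ℂ) = q x - h - D0 := by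
    simp only [q, Ip, I0, I1, Set.indicator_of_mem mem, smul_eq_mul]
    rw [Complex.ofReal_cpow hx0.le, Complex.ofReal_cpow hx0.le]
    push_cast
    rw [Complex.cpow_zero]
    ring
  rw [qx]
  have one : 1 ≤ x ^ (-c) := Real.one_le_rpow_of_pos_of_le_one_of_nonpos hx0 hx1.le (by linarith)
  have := norm_sub_le (q x - h) D0
  have := norm_sub_le (q x) h
  have := mul_le_mul_of_nonneg_left one (norm_nonneg h)
  have := mul_le_mul_of_nonneg_left one (norm_nonneg D0)
  nlinarith

def FFt (b : ℕ → ℝ) (i : ℕ × ℕ) (t : ℝ) : ℝ :=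
  b (i.1 + 1) * ((i.1 : ℝ) + 1) * Real.exp (-(((i.1 : ℝ) + 1) * ((i.2 : ℝ) + 1)) * t)

def FF (b : ℕ → ℝ) (t : ℝ) : ℝ := ∑' i : ℕ × ℕ, FFt b i t

lemma FFt_nonneg (b : ℕ → ℝ) (hb : ∀ k, 0 ≤ b k) (i : ℕ × ℕ) (t : ℝ) : 0 ≤ FFt b i t := by
  unfold FFt
  have := hb (i.1+1)
  positivity

lemma summ_D {b : ℕ → ℝ} (hb : ∀ k, 0 ≤ b k) {ρ C₀ A : ℝ} {Dc : ℂ → ℂ} (h1 : M1 b ρ C₀ A Dc)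
    {σ : ℝ} (hσ : ρ < σ) : Summable (fun k : ℕ => b (k + 1) * ((k : ℝ) + 1) ^ (-σ)) := by
  obtain ⟨-, -, -, -, hD, -⟩ := h1
  have := (hD σ (by simpa using hσ)).summable.norm
  refine this.congr (fun k => ?_)
  rw [norm_mul, Complex.norm_real, Real.norm_of_nonneg (hb _), Complex.norm_natCast_cpow_of_pos (Nat.succ_pos k)]
  simp

lemma summ_pair {b : ℕ → ℝ} (hb : ∀ k, 0 ≤ b k) {ρ C₀ A : ℝ} {Dc : ℂ → ℂ} (h1 : M1 b ρ C₀ A Dc)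
    {σ : ℝ} (hσ : ρ + 1 < σ) : Summable (fun i : ℕ × ℕ => b (i.1 + 1) * ((i.1 : ℝ) + 1) /
      (((i.1 : ℝ) + 1) * ((i.2 : ℝ) + 1)) ^ σ) := by
  have s1 := summ_D hb h1 (show ρ < σ - 1 by linarith)
  have hρ := h1.1
  have s2 : Summable (fun m : ℕ => ((m:ℝ) + 1) ^ (-σ)) := by
    have := (summable_nat_add_iff 1).2 (Real.summable_nat_rpow.2 (show -σ < -1 by linarith))
    simpa using this
  have := s1.mul_of_nonneg s2 (fun k => mul_nonneg (hb _) (by positivity)) (fun k => by positivity)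
  refine this.congr (fun i => ?_)
  have p1 : (0:ℝ) < (i.1:ℝ) + 1 := by positivity
  have p2 : (0:ℝ) < (i.2:ℝ) + 1 := by positivity
  rw [Real.mul_rpow p1.le p2.le, neg_sub, Real.rpow_sub p1, Real.rpow_one, Real.rpow_neg p2.le]
  field_simp

lemma FFt_summable {b : ℕ → ℝ} (hb : ∀ k, 0 ≤ b k) {ρ C₀ A : ℝ} {Dc : ℂ → ℂ} (h1 : M1 b ρ C₀ A Dc)
    {t : ℝ} (ht : 0 < t) : Summable (fun i => FFt b i t) := by
  obtain ⟨N, hN⟩ := exists_nat_gt (ρ + 1)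
  have s := (summ_pair hb h1 hN).mul_left ((N.factorial : ℝ) / t ^ N)
  refine Summable.of_nonneg_of_le (fun i => FFt_nonneg b hb i t) (fun i => ?_) s
  unfold FFt
  rw [Real.rpow_natCast]
  set u : ℝ := ((i.1 : ℝ) + 1) * ((i.2 : ℝ) + 1) with hu
  have hu0 : 0 < u := by positivity
  have := Real.pow_div_factorial_le_exp (u * t) (by positivity) N
  have hf : (0:ℝ) < N.factorial := by exact_mod_cast N.factorial_pos
  have e : Real.exp (-u * t) ≤ (N.factorial : ℝ) / (u * t) ^ N := by
    rw [neg_mul, Real.exp_neg, inv_le_comm₀ (Real.exp_pos _) (by positivity), inv_div]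
    exact this
  have hbk := hb (i.1+1)
  calc _ ≤ b (i.1+1) * ((i.1:ℝ)+1) * ((N.factorial : ℝ) / (u * t) ^ N) := by gcongr
    _ = _ := by rw [mul_pow]; field_simp

lemma FFt_anti {b : ℕ → ℝ} (hb : ∀ k, 0 ≤ b k) (i : ℕ × ℕ) {x y : ℝ} (h : x ≤ y) : FFt b i y ≤ FFt b i x := by
  unfold FFt
  have hbk := hb (i.1+1)
  have : (0:ℝ) ≤ ((i.1 : ℝ) + 1) * ((i.2 : ℝ) + 1) := by positivity
  gcongr ?_ * Real.exp ?_
  nlinarith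

lemma FF_contAt {b : ℕ → ℝ} (hb : ∀ k, 0 ≤ b k) {ρ C₀ A : ℝ} {Dc : ℂ → ℂ} (h1 : M1 b ρ C₀ A Dc)
    {t : ℝ} (ht : 0 < t) : ContinuousAt (FF b) t := by
  have : ContinuousOn (FF b) (Set.Ici (t/2)) := by
    refine continuousOn_tsum (fun i => ?_) (FFt_summable hb h1 (half_pos ht)) (fun i x hx => ?_)
    · unfold FFt; fun_prop
    · rw [Real.norm_of_nonneg (FFt_nonneg b hb i x)]
      exact FFt_anti hb i hx
  exact this.continuousAt (Ici_mem_nhds (by linarith))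

lemma exists_b_pos {b : ℕ → ℝ} (hb : ∀ k, 0 ≤ b k) {ρ C₀ A : ℝ} {Dc : ℂ → ℂ} (h1 : M1 b ρ C₀ A Dc) :
    ∃ k, 0 < b (k + 1) := by
  by_contra hcon
  push Not at hcon
  have hz : ∀ k, b (k+1) = 0 := fun k => le_antisymm (hcon k) (hb _)
  obtain ⟨hρ, hC, -, hA, hD, -, φ, hφ, hφD⟩ := h1
  have hD0 : ∀ s : ℂ, ρ < s.re → Dc s = 0 := by
    intro s hs
    have := hD s hs
    simp only [hz, Complex.ofReal_zero, zero_mul] at this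
    exact this.unique hasSum_zero
  have hc : ContinuousAt φ ρ := (hφ ρ (by simp; linarith)).continuousAt
  have e : ∀ ε : ℝ, 0 < ε → (A:ℂ) = -(ε * φ (ρ + ε)) := by
    intro ε hε
    have hε' : (ε:ℂ) ≠ 0 := by exact_mod_cast hε.ne'
    have := hφD (ρ + ε) (by simp; linarith) (by simpa using hε')
    rw [hD0 _ (by simpa using hε)] at this
    rw [add_sub_cancel_left] at this
    have h2 : (A:ℂ) / ε = - φ (ρ + ε) := by linear_combination -this
    rw [div_eq_iff hε'] at h2
    rw [h2]; ring
  have lim : Tendsto (fun ε : ℝ => -((ε:ℂ) * φ (ρ + ε))) (𝓝[>] 0) (𝓝 0) := by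
    have t1 : Tendsto (fun ε : ℝ => (ε:ℂ)) (𝓝[>] 0) (𝓝 0) := by
      have : Continuous (fun ε : ℝ => (ε:ℂ)) := by fun_prop
      simpa using (this.tendsto 0).mono_left nhdsWithin_le_nhds
    have t2 : Tendsto (fun ε : ℝ => φ (ρ + ε)) (𝓝[>] 0) (𝓝 (φ ρ)) := by
      refine hc.tendsto.comp ?_
      simpa using t1.const_add (ρ:ℂ)
    simpa using (t1.mul t2).neg
  have := tendsto_nhds_unique lim ((tendsto_const_nhds (x := (A:ℂ))).congr' (by
    filter_upwards [self_mem_nhdsWithin] with ε hε using e ε hε))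
  have : A = 0 := by exact_mod_cast this.symm
  linarith

lemma FF_strictAnti {b : ℕ → ℝ} (hb : ∀ k, 0 ≤ b k) {ρ C₀ A : ℝ} {Dc : ℂ → ℂ} (h1 : M1 b ρ C₀ A Dc)
    {x y : ℝ} (hx : 0 < x) (hxy : x < y) : FF b y < FF b x := by
  obtain ⟨k, hk⟩ := exists_b_pos hb h1
  refine Summable.tsum_lt_tsum (i := (k, 0)) (fun i => FFt_anti hb i hxy.le) ?_ (FFt_summable hb h1 (hx.trans hxy)) (FFt_summable hb h1 hx)
  unfold FFt
  have hp : (0:ℝ) < ((k:ℝ)+1) := by positivity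
  gcongr ?_ * Real.exp ?_
  simp
  nlinarith

lemma Abf_eq {b : ℕ → ℝ} (hb : ∀ k, 0 ≤ b k) {ρ C₀ A : ℝ} {Dc : ℂ → ℂ} (h1 : M1 b ρ C₀ A Dc)
    {x : ℝ} (hx : 0 < x) : Abf b (Real.exp (-x)) = FF b x := by
  set r := Real.exp (-x) with hr
  set r1 := Real.exp (-(x/2)) with hr1
  have hr0 : 0 < r := Real.exp_pos _
  have hr10 : 0 < r1 := Real.exp_pos _
  have hr11 : r1 < 1 := by rw [hr1, ← Real.exp_zero]; exact Real.exp_lt_exp.2 (by linarith)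
  have hrr1 : r < r1 := Real.exp_lt_exp.2 (by linarith)
  have S1 : Summable (fun k : ℕ => b (k+1) * ((k:ℝ)+1) * r1 ^ (k+1)) := by
    have := (FFt_summable hb h1 (half_pos hx)).comp_injective (i := fun k : ℕ => (k, 0)) (fun a b h => by simpa using h)
    refine this.congr (fun k => ?_)
    simp only [FFt, Function.comp, hr1]
    rw [← Real.exp_nat_mul]
    push_cast
    congr 2
    ring
  have S2 : Summable (fun k : ℕ => b (k+1) * ((k:ℝ)+1) * r1 ^ k / (1 - r1)) := by
    refine (S1.mul_left (r1⁻¹ * (1-r1)⁻¹)).congr (fun k => ?_)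
    rw [pow_succ]
    field_simp
  have hder : HasDerivAt (fun z => ∑' k : ℕ, b (k + 1) * Real.log (1 - z ^ (k + 1)))
      (∑' k : ℕ, b (k+1) * (-(((k:ℝ)+1) * r ^ k) / (1 - r ^ (k+1)))) r := by
    have key : ∀ (k : ℕ) (y : ℝ), y ∈ Set.Ioo (-r1) r1 → |y| ^ k ≤ r1 ^ k ∧ 1 - r1 ≤ 1 - y ^ (k+1) := by
      intro k y hy
      have hy' : |y| ≤ r1 := abs_le.2 ⟨hy.1.le, hy.2.le⟩
      refine ⟨pow_le_pow_left₀ (abs_nonneg _) hy' k, ?_⟩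
      have a1 : y ^ (k+1) ≤ |y| ^ (k+1) := by rw [← abs_pow]; exact le_abs_self _
      have a2 : |y| ^ (k+1) ≤ r1 ^ (k+1) := pow_le_pow_left₀ (abs_nonneg _) hy' _
      have a3 : r1 ^ (k+1) ≤ r1 := pow_le_of_le_one hr10.le hr11.le (Nat.succ_ne_zero k)
      linarith
    refine hasDerivAt_tsum_of_isPreconnected (t := Set.Ioo (-r1) r1) (y₀ := 0)
      (g := fun k z => b (k + 1) * Real.log (1 - z ^ (k + 1)))
      (g' := fun k z => b (k+1) * (-(((k:ℝ)+1) * z ^ k) / (1 - z ^ (k+1)))) S2 isOpen_Ioo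
      isPreconnected_Ioo (fun k y hy => ?_) (fun k y hy => ?_) ⟨by linarith, hr10⟩ ?_ ⟨by linarith, hrr1⟩
    · have hne : 1 - y ^ (k+1) ≠ 0 := by have := (key k y hy).2; linarith
      have := ((hasDerivAt_pow (k+1) y).const_sub 1).log hne
      simpa using this.const_mul (b (k+1))
    · have := (key k y hy)
      rw [norm_mul, norm_div, norm_neg, norm_mul, Real.norm_of_nonneg (hb _), Real.norm_of_nonneg (show (0:ℝ) ≤ (k:ℝ)+1 by positivity), norm_pow, Real.norm_eq_abs, Real.norm_of_nonneg (show 0 ≤ 1 - y^(k+1) by linarith), show b (k+1) * ((k:ℝ)+1) * r1 ^ k / (1 - r1) = b (k+1) * (((k:ℝ)+1) * r1 ^ k / (1 - r1)) by ring]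
      have hbk := hb (k+1)
      have : 0 < 1 - r1 := by linarith
      gcongr
      · exact abs_le.2 ⟨hy.1.le, hy.2.le⟩
      · have := (key k y hy).2
        linarith
    · simp
  have hF : HasDerivAt (Fb b) (-(∑' k : ℕ, b (k+1) * (-(((k:ℝ)+1) * r ^ k) / (1 - r ^ (k+1))))) r := hder.neg
  rw [Abf, hF.deriv, ← tsum_neg, ← tsum_mul_left, FF, (FFt_summable hb h1 hx).tsum_prod]
  refine tsum_congr (fun k => ?_)
  have hgeo : HasSum (fun m : ℕ => FFt b (k, m) x) (b (k+1) * ((k:ℝ)+1) * (r ^ (k+1) * (1 - r ^ (k+1))⁻¹)) := by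
    have hlt : r ^ (k+1) < 1 := pow_lt_one₀ hr0.le (by linarith) (Nat.succ_ne_zero k)
    have := ((hasSum_geometric_of_lt_one (pow_nonneg hr0.le (k+1)) hlt).mul_left (r ^ (k+1))).mul_left (b (k+1) * ((k:ℝ)+1))
    refine this.congr_fun (fun m => ?_)
    simp only [FFt]
    rw [← pow_succ', ← pow_mul, hr, ← Real.exp_nat_mul]
    push_cast
    congr 2
    ring
  rw [hgeo.tsum_eq, pow_succ]
  ring

lemma FF_mellin {b : ℕ → ℝ} (hb : ∀ k, 0 ≤ b k) {ρ C₀ A : ℝ} {Dc : ℂ → ℂ} (h1 : M1 b ρ C₀ A Dc)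
    {s : ℂ} (hs : ρ + 1 < s.re) : mellin (fun t => ((FF b t : ℝ) : ℂ)) s =
      Complex.Gamma s * (riemannZeta s * Dc (s - 1)) := by
  have hρ := h1.1
  have hD := h1.2.2.2.2.1
  have hm := hasSum_mellin (ι := ℕ × ℕ) (a := fun i => ((b (i.1+1) * ((i.1:ℝ)+1) : ℝ) : ℂ))
    (p := fun i => ((i.1 : ℝ) + 1) * ((i.2 : ℝ) + 1)) (F := fun t => ((FF b t : ℝ) : ℂ)) (s := s)
    (fun i => Or.inr (by positivity)) (by linarith) (fun t ht => ?_) ?_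
  · have s1 := hD (s-1) (by simp; linarith)
    have s2 : HasSum (fun m : ℕ => 1 / ((m:ℂ)+1) ^ s) (riemannZeta s) := by
      rw [zeta_eq_tsum_one_div_nat_add_one_cpow (by linarith)]
      apply Summable.hasSum
      have := (summable_nat_add_iff 1).2 (Complex.summable_one_div_nat_cpow.2 (show 1 < s.re by linarith))
      simpa using this
    have s12 := summable_mul_of_summable_norm s1.summable.norm s2.summable.norm
    have s3' := HasSum.mul s1 s2 s12
    have s3 := HasSum.mul_left (Complex.Gamma s) s3'
    have e : ∀ i : ℕ × ℕ, Complex.Gamma s * ((b (i.1+1) * ((i.1:ℝ)+1) : ℝ) : ℂ) / ((((i.1 : ℝ) + 1) * ((i.2 : ℝ) + 1) : ℝ) : ℂ) ^ s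
        = Complex.Gamma s * ((b (i.1+1) : ℂ) * ((i.1 + 1 : ℕ) : ℂ) ^ (-(s-1)) * (1 / ((i.2:ℂ)+1) ^ s)) := by
      intro i
      have hi : ((i.1:ℂ)+1) ≠ 0 := by exact_mod_cast Nat.succ_ne_zero i.1
      have e1 : ((((i.1 : ℝ) + 1) * ((i.2 : ℝ) + 1) : ℝ) : ℂ) ^ s = ((i.1:ℂ)+1) ^ s * ((i.2:ℂ)+1) ^ s := by
        rw [Complex.ofReal_mul, Complex.mul_cpow_ofReal_nonneg (by positivity) (by positivity)]
        push_cast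
        rfl
      rw [e1]
      push_cast
      rw [neg_sub, Complex.cpow_sub _ _ hi, Complex.cpow_one]
      field_simp
    rw [mul_comm (riemannZeta s)]
    exact hm.unique (by simpa only [e] using s3)
  · have := Complex.hasSum_ofReal.2 (FFt_summable hb h1 ht).hasSum
    convert this using 1
    · ext i
      simp [FFt]
    · rfl
  · refine (summ_pair hb h1 hs).congr (fun i => ?_)
    rw [Complex.norm_real, Real.norm_of_nonneg (mul_nonneg (hb _) (by positivity))]

lemma FF_mellin_conv {b : ℕ → ℝ} (hb : ∀ k, 0 ≤ b k) {ρ C₀ A : ℝ} {Dc : ℂ → ℂ} (h1 : M1 b ρ C₀ A Dc)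
    {s : ℂ} (hs : ρ + 1 < s.re) : MellinConvergent (fun t => ((FF b t : ℝ) : ℂ)) s := by
  have hρ := h1.1
  have hD := h1.2.2.2.2.1
  obtain ⟨k, hk⟩ := exists_b_pos hb h1
  -- convergence at the real point `s.re`
  have hreal : MellinConvergent (fun t => ((FF b t : ℝ) : ℂ)) (s.re : ℂ) := by
    refine Integrable.of_integral_ne_zero ?_
    change mellin (fun t => ((FF b t : ℝ) : ℂ)) (s.re : ℂ) ≠ 0
    rw [FF_mellin hb h1 (by simpa using hs)]
    refine mul_ne_zero (Complex.Gamma_ne_zero_of_re_pos (by simp; linarith))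
      (mul_ne_zero (riemannZeta_ne_zero_of_one_lt_re (by simp; linarith)) ?_)
    have hd := hD ((s.re:ℂ) - 1) (by simp; linarith)
    have hr : HasSum (fun k : ℕ => b (k+1) * ((k:ℝ)+1) ^ (-(s.re - 1))) (Dc ((s.re:ℂ) - 1)).re := by
      have := Complex.hasSum_re hd
      convert this using 1
      ext k
      have : ((k+1 : ℕ) : ℂ) ^ (-((s.re:ℂ) - 1)) = ((((k:ℝ)+1) ^ (-(s.re - 1)) : ℝ) : ℂ) := by
        rw [Complex.ofReal_cpow (by positivity)]
        push_cast
        rfl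
      rw [this, ← Complex.ofReal_mul, Complex.ofReal_re]
    have hpos : 0 < (Dc ((s.re:ℂ) - 1)).re := by
      rw [← hr.tsum_eq]
      exact hr.summable.tsum_pos (fun k => mul_nonneg (hb _) (by positivity)) k (by positivity)
    intro h0
    rw [h0] at hpos
    simp at hpos
  have hmeas : ContinuousOn (fun t : ℝ => (t:ℂ) ^ (s - 1) • ((FF b t : ℝ) : ℂ)) (Set.Ioi 0) := by
    intro t ht
    have ht' : (0:ℝ) < t := ht
    refine ContinuousAt.continuousWithinAt (ContinuousAt.fun_smul ?_ ?_)
    · exact Complex.continuousAt_ofReal_cpow_const t _ (Or.inr ht'.ne')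
    · exact Complex.continuous_ofReal.continuousAt.comp (FF_contAt hb h1 ht')
  refine Integrable.mono hreal (hmeas.aestronglyMeasurable measurableSet_Ioi) ?_
  refine (ae_restrict_iff' measurableSet_Ioi).2 (Eventually.of_forall fun t ht => ?_)
  have ht' : (0:ℝ) < t := ht
  rw [norm_smul, norm_smul, Complex.norm_cpow_eq_rpow_re_of_pos ht', Complex.norm_cpow_eq_rpow_re_of_pos ht']
  simp



lemma taylor2 (r : ℝ) : (fun y : ℝ => (1 + y) ^ r - 1 - r * y) =O[𝓝 0] fun y => y ^ 2 := by
  have hd : HasDerivAt (fun z : ℝ => r * ((1 + z) ^ (r - 1) - 1)) (r * (((0 + 1) * (r - 1) * (1 + 0) ^ (r - 1 - 1)))) 0 := by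
    have h1 : HasDerivAt (fun z : ℝ => 1 + z) (0 + 1) 0 := (hasDerivAt_const _ _).add (hasDerivAt_id _)
    have := h1.rpow_const (p := r - 1) (Or.inl (by norm_num))
    exact (this.sub_const 1).const_mul r
  have hO := hd.isBigO_sub
  simp only [add_zero, Real.one_rpow, sub_self, mul_zero, sub_zero] at hO
  obtain ⟨C, hC⟩ := hO.bound
  obtain ⟨ε, hε, hball⟩ := Metric.eventually_nhds_iff_ball.1 hC
  refine IsBigO.of_bound C ?_
  filter_upwards [Metric.ball_mem_nhds (0:ℝ) (lt_min hε (by norm_num : (0:ℝ) < 1))] with y hy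
  have hy' : |y| < min ε 1 := by simpa using hy
  have hC0 : 0 ≤ C * ‖y‖ := (norm_nonneg _).trans (hball y (by simpa using hy'.trans_le (min_le_left _ _)))
  have mv := Convex.norm_image_sub_le_of_norm_hasDerivWithin_le (f := fun y : ℝ => (1 + y) ^ r - 1 - r * y)
    (f' := fun z : ℝ => r * ((1 + z) ^ (r - 1) - 1)) (s := Metric.closedBall 0 |y|) (C := C * ‖y‖) (x := 0) (y := y)
    (fun z hz => ?_) (fun z hz => ?_) (convex_closedBall 0 |y|) (by simp) (by simp)
  · simp only [add_zero, Real.one_rpow, sub_self, mul_zero, sub_zero] at mv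
    rw [norm_pow, pow_two, ← mul_assoc]
    exact mv
  · have hz' : |z| ≤ |y| := by simpa using hz
    have : |z| < 1 := hz'.trans_lt (hy'.trans_le (min_le_right _ _))
    have h1 : HasDerivAt (fun z : ℝ => 1 + z) 1 z := (hasDerivAt_id z).const_add 1
    have h2 := h1.rpow_const (p := r) (Or.inl (by linarith [(abs_lt.1 this).1]))
    have h3 := (h2.sub_const 1).sub ((hasDerivAt_id z).const_mul r)
    refine (h3.congr_deriv ?_).hasDerivWithinAt
    ring
  · have hz' : |z| ≤ |y| := by simpa using hz
    have := hball z (by simpa using hz'.trans_lt (hy'.trans_le (min_le_left _ _)))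
    by_cases hy0 : y = 0
    · subst hy0
      have : z = 0 := by simpa using hz'
      subst this
      simp
    · have hypos : 0 < ‖y‖ := norm_pos_iff.2 hy0
      have hCn : 0 ≤ C := by
        by_contra h
        push Not at h
        have := mul_neg_of_neg_of_pos h hypos
        linarith
      refine this.trans ?_
      exact mul_le_mul_of_nonneg_left hz' hCn

lemma lip1 (r : ℝ) : (fun y : ℝ => (1 + y) ^ r - 1) =O[𝓝 0] fun y => y := by
  have h1 : HasDerivAt (fun z : ℝ => 1 + z) 1 0 := (hasDerivAt_id (0:ℝ)).const_add 1
  have := (h1.rpow_const (p := r) (Or.inl (by norm_num))).isBigO_sub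
  simpa using this

lemma bdd1 (r : ℝ) : (fun y : ℝ => (1 + y) ^ r) =O[𝓝 0] fun _ => (1:ℝ) := by
  have : ContinuousAt (fun y : ℝ => (1 + y) ^ r) 0 :=
    ContinuousAt.rpow_const (by fun_prop) (Or.inl (by norm_num))
  exact this.tendsto.isBigO_one ℝ

lemma inversion (G : ℝ → ℝ) (h ρ C₀ d K : ℝ) (hh : 0 < h) (hρ : 0 < ρ) (hC : 0 < C₀)
    (hG : ∀ x : ℝ, 0 < x → x < 1 → |G x - h * x ^ (-(ρ + 1)) - d * x ^ (-1:ℝ)| ≤ K * x ^ (-(1 - C₀)))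
    (α : ℕ → ℝ) (hα : ∀ᶠ n : ℕ in atTop, 0 < α n ∧ G (α n) = n) (hα0 : Tendsto α atTop (𝓝 0)) :
    (fun n : ℕ => α n - ((h / n) ^ ((1:ℝ) / (ρ + 1)) + d / ((ρ + 1) * n)))
        =O[atTop] fun n : ℕ => (n : ℝ) ^ (-1 - min (C₀ / (ρ + 1)) (ρ / (ρ + 1))) := by
  set p := ρ + 1 with hp
  have hp0 : 0 < p := by linarith
  set a : ℕ → ℝ := fun n => (h / n) ^ ((1:ℝ) / p) with ha
  set u : ℕ → ℝ := fun n => n * (α n) ^ p / h - 1 with hu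
  have hα1 : ∀ᶠ n in atTop, α n < 1 := hα0.eventually (gt_mem_nhds one_pos)
  have hn1 : ∀ᶠ n : ℕ in atTop, 1 ≤ n := eventually_ge_atTop 1
  -- (1)
  have o1 : (fun n => u n - d / h * α n ^ ρ) =O[atTop] fun n => α n ^ (ρ + C₀) := by
    refine IsBigO.of_bound (K / h) ?_
    filter_upwards [hα, hα1] with n ⟨hn, hGn⟩ hn1
    have := hG (α n) hn hn1
    rw [hGn] at this
    have hxp : 0 < α n ^ p := Real.rpow_pos_of_pos hn p
    have e1 : α n ^ p * α n ^ (-p) = 1 := by rw [← Real.rpow_add hn]; simp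
    have e2 : α n ^ p * α n ^ (-1:ℝ) = α n ^ ρ := by rw [← Real.rpow_add hn]; congr 1; rw [hp]; ring
    have e3 : α n ^ p * α n ^ (-(1 - C₀)) = α n ^ (ρ + C₀) := by rw [← Real.rpow_add hn]; congr 1; rw [hp]; ring
    have e4 : u n - d / h * α n ^ ρ = (α n ^ p / h) * (n - h * α n ^ (-p) - d * α n ^ (-1:ℝ)) := by
      rw [← e2]
      simp only [hu]
      field_simp
      linear_combination h * e1
    rw [e4, norm_mul, Real.norm_of_nonneg (by positivity : 0 ≤ α n ^ p / h), Real.norm_eq_abs, Real.norm_of_nonneg (by positivity)]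
    calc _ ≤ α n ^ p / h * (K * α n ^ (-(1 - C₀))) := by gcongr
      _ = _ := by rw [← e3]; ring
  have xpow : ∀ e : ℝ, 0 < e → Tendsto (fun n => α n ^ e) atTop (𝓝 0) := by
    intro e he
    have := hα0.rpow_const (p := e) (Or.inr he.le)
    rwa [Real.zero_rpow he.ne'] at this
  have o2 : u =O[atTop] fun n => α n ^ ρ := by
    have q1 : (fun n => α n ^ (ρ + C₀)) =O[atTop] fun n => α n ^ ρ := by
      refine IsBigO.of_bound 1 ?_
      filter_upwards [hα, hα1] with n ⟨hn, _⟩ hn1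
      rw [Real.norm_of_nonneg (by positivity), Real.norm_of_nonneg (by positivity), one_mul]
      exact Real.rpow_le_rpow_of_exponent_ge hn hn1.le (by linarith)
    have q2 := (o1.trans q1).add ((isBigO_refl (fun n => α n ^ ρ) atTop).const_mul_left (d / h))
    simpa using q2
  have u0 : Tendsto u atTop (𝓝 0) := o2.trans_tendsto (xpow ρ hρ)
  have apos : ∀ᶠ n in atTop, 0 < a n := by
    filter_upwards [hn1] with n hn
    have : (0:ℝ) < n := by exact_mod_cast hn
    simp only [ha]; positivity
  have ap : ∀ᶠ n : ℕ in atTop, a n ^ p = h / n := by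
    filter_upwards [hn1] with n hn
    simp only [ha]
    rw [← Real.rpow_mul (by positivity), one_div_mul_cancel hp0.ne', Real.rpow_one]
  have xe : ∀ e : ℝ, ∀ᶠ n in atTop, α n ^ e = a n ^ e * (1 + u n) ^ (e / p) := by
    intro e
    filter_upwards [hα, hn1, apos, ap] with n ⟨hn, _⟩ hn1 hapos hap
    have hnp : (0:ℝ) < n := by exact_mod_cast hn1
    have : 1 + u n = (α n / a n) ^ p := by
      rw [Real.div_rpow hn.le hapos.le, hap]
      simp only [hu]
      field_simp
      ring
    have hae := Real.rpow_pos_of_pos hapos e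
    rw [this, ← Real.rpow_mul (show 0 ≤ α n / a n from (div_pos hn hapos).le), show p * (e/p) = e by field_simp, Real.div_rpow hn.le hapos.le]
    rw [mul_div_cancel₀ _ hae.ne']
  have oxe : ∀ e : ℝ, (fun n => α n ^ e) =O[atTop] fun n => a n ^ e := by
    intro e
    have := (isBigO_refl (fun n => a n ^ e) atTop).mul ((bdd1 (e / p)).comp_tendsto u0)
    simp only [Function.comp, mul_one] at this
    exact this.congr' ((xe e).mono fun n hn => hn.symm) EventuallyEq.rfl
  have ou : u =O[atTop] fun n => a n ^ ρ := o2.trans (oxe ρ)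
  -- pieces
  have t1 : (fun n => a n * ((1 + u n) ^ (1 / p) - 1 - 1 / p * u n)) =O[atTop] fun n => a n * (a n ^ ρ) ^ 2 := by
    have := (taylor2 (1 / p)).comp_tendsto u0
    exact (isBigO_refl a atTop).mul (this.trans (ou.pow 2))
  have t2 : (fun n => a n * (1 / p * (u n - d / h * α n ^ ρ))) =O[atTop] fun n => a n * a n ^ (ρ + C₀) :=
    (isBigO_refl a atTop).mul ((o1.trans (oxe _)).const_mul_left _)
  have t3 : (fun n => a n * (d / (p * h) * (a n ^ ρ * ((1 + u n) ^ (ρ / p) - 1)))) =O[atTop] fun n => a n * (a n ^ ρ) ^ 2 := by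
    have := (lip1 (ρ / p)).comp_tendsto u0
    have := (isBigO_refl (fun n => a n ^ ρ) atTop).mul (this.trans ou)
    simp only [← pow_two] at this
    exact (isBigO_refl a atTop).mul (this.const_mul_left _)
  have apow : ∀ e : ℝ, min (C₀ / p) (ρ / p) ≤ e / p → (fun n => a n ^ (ρ + 1 + e)) =O[atTop]
      fun n : ℕ => (n : ℝ) ^ (-1 - min (C₀ / p) (ρ / p)) := by
    intro e he
    refine IsBigO.of_bound (h ^ ((p + e) / p)) ?_
    filter_upwards [hn1] with n hn
    have hnp : (0:ℝ) < n := by exact_mod_cast hn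
    simp only [ha]
    rw [Real.norm_of_nonneg (by positivity), Real.norm_of_nonneg (by positivity), ← Real.rpow_mul (by positivity),
      show 1 / p * (ρ + 1 + e) = (p + e) / p by rw [← hp]; ring, Real.div_rpow hh.le hnp.le, div_eq_mul_inv, ← Real.rpow_neg hnp.le]
    gcongr
    · exact_mod_cast hn
    · rw [add_div, div_self hp0.ne']; linarith
  have g1 := (t1.congr' EventuallyEq.rfl (g₂ := fun n => a n ^ (ρ + 1 + ρ)) (by
    filter_upwards [apos] with n hn
    rw [Real.rpow_add hn, Real.rpow_add hn, Real.rpow_one]; ring)).trans (apow ρ (min_le_right _ _))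
  have g2 := (t2.congr' EventuallyEq.rfl (g₂ := fun n => a n ^ (ρ + 1 + C₀)) (by
    filter_upwards [apos] with n hn
    rw [Real.rpow_add hn, Real.rpow_add hn, Real.rpow_add hn, Real.rpow_one]; ring)).trans (apow C₀ (min_le_left _ _))
  have g3 := (t3.congr' EventuallyEq.rfl (g₂ := fun n => a n ^ (ρ + 1 + ρ)) (by
    filter_upwards [apos] with n hn
    rw [Real.rpow_add hn, Real.rpow_add hn, Real.rpow_one]; ring)).trans (apow ρ (min_le_right _ _))
  refine ((g1.add g2).add g3).congr' ?_ EventuallyEq.rfl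
  filter_upwards [xe 1, xe ρ, apos, ap, hn1] with n x1 xρ hapos hap hn1
  have hnp : (0:ℝ) < n := by exact_mod_cast hn1
  rw [Real.rpow_one, Real.rpow_one] at x1
  have en : d / (p * n) = d / (p * h) * (a n * a n ^ ρ) := by
    have : a n * a n ^ ρ = h / n := by rw [← hap, hp, Real.rpow_add hapos, Real.rpow_one]; ring
    rw [this]; field_simp
  change _ = α n - (a n + d / (p * n))
  rw [en]
  nth_rewrite 2 [x1]
  rw [mul_sub (a n ^ ρ), ← xρ]
  field_simp
  ring


lemma zeta_re_pos {p : ℝ} (hp : 1 < p) : 0 < (riemannZeta (p : ℂ)).re := by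
  have hs : Summable (fun n : ℕ => 1 / ((n : ℂ) + 1) ^ (p : ℂ)) := by
    have := (summable_nat_add_iff 1).2 (Complex.summable_one_div_nat_cpow.2 (show 1 < ((p:ℂ)).re by simpa using hp))
    simpa using this
  have h1 := hs.hasSum
  rw [← zeta_eq_tsum_one_div_nat_add_one_cpow (by simpa using hp)] at h1
  have h2 : HasSum (fun k : ℕ => 1 / ((k:ℝ)+1) ^ p) (riemannZeta (p : ℂ)).re := by
    have := Complex.hasSum_re h1
    convert this using 1
    ext k
    have : ((k : ℂ) + 1) ^ (p : ℂ) = ((((k:ℝ)+1) ^ p : ℝ) : ℂ) := by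
      rw [Complex.ofReal_cpow (by positivity)]
      push_cast
      rfl
    rw [this, ← Complex.ofReal_one, ← Complex.ofReal_div, Complex.ofReal_re]
  rw [← h2.tsum_eq]
  exact h2.summable.tsum_pos (fun k => by positivity) 0 (by positivity)

lemma hMein_pos {ρ A : ℝ} (hρ : 0 < ρ) (hA : 0 < A) : 0 < hMein ρ A := by
  unfold hMein
  have h := zeta_re_pos (p := ρ + 1) (by linarith)
  have := Real.Gamma_pos_of_pos (show 0 < ρ + 1 by linarith)
  push_cast at h
  positivity

lemma FF_asymp {b : ℕ → ℝ} (hb : ∀ k, 0 ≤ b k) {ρ C₀ A C₁ : ℝ} {Dc : ℂ → ℂ} (h1 : M1 b ρ C₀ A Dc)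
    (h2 : M2 C₀ C₁ Dc) : ∃ K : ℝ, ∀ x : ℝ, 0 < x → x < 1 →
      |FF b x - hMein ρ A * x ^ (-(ρ + 1)) - (Dc 0).re * x ^ (-1 : ℝ)| ≤ K * x ^ (-(1 - C₀)) := by
  have h1' := h1
  obtain ⟨hρ, hC, hC1, hA, -, -, φ, hφ, hDφ⟩ := h1'
  obtain ⟨hC₁, K₂, y₀, hM2⟩ := h2
  have hps : ∀ s : ℂ, s ≠ ((ρ + 1 : ℝ) : ℂ) → s - 1 ≠ (ρ : ℂ) := by
    intro s hs h
    apply hs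
    push_cast
    rw [← h]; ring
  set W : ℂ → ℂ := fun s => PP s * ((A : ℂ) + (s - ((ρ + 1 : ℝ) : ℂ)) * φ (s - 1)) with hWdef
  have hWeq : ∀ s : ℂ, 1 - C₀ ≤ s.re → s ≠ ((ρ + 1 : ℝ) : ℂ) →
      W s / ((s - 1) * (s - ((ρ + 1 : ℝ) : ℂ))) = PP s / (s - 1) * Dc (s - 1) := by
    intro s hs hsp
    have e1 := hDφ (s - 1) (by simp; linarith) (hps s hsp)
    have e2 : s - ((ρ + 1 : ℝ) : ℂ) ≠ 0 := sub_ne_zero.2 hsp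
    have e3 : s - 1 - (ρ : ℂ) = s - ((ρ + 1 : ℝ) : ℂ) := by push_cast; ring
    have e4 : (A : ℂ) + (s - ((ρ + 1 : ℝ) : ℂ)) * φ (s - 1) = (s - ((ρ + 1 : ℝ) : ℂ)) * Dc (s - 1) := by
      rw [e1, e3]; field_simp
    simp only [hWdef]
    rw [e4]
    by_cases h : s - 1 = 0
    · simp [h]
    · field_simp
  have hW : DifferentiableOn ℂ W {s | 1 - C₀ ≤ s.re} := by
    intro s hs
    have hs' : 1 - C₀ ≤ s.re := hs
    refine DifferentiableAt.differentiableWithinAt ?_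
    have d1 := PP_diff (s := s) (by linarith)
    have d2 : DifferentiableAt ℂ (fun s : ℂ => φ (s - 1)) s :=
      DifferentiableAt.comp (f := fun s : ℂ => s - 1) s (hφ (s - 1) (by simp; linarith)) (by fun_prop)
    have d3 : DifferentiableAt ℂ (fun s : ℂ => (s - ((ρ + 1 : ℝ) : ℂ))) s := by fun_prop
    exact d1.mul ((d3.mul d2).const_add _)
  have hbd : ∃ K T : ℝ, 0 ≤ K ∧ ∀ s : ℂ, 1 - C₀ ≤ s.re → s.re ≤ ρ + 2 → T ≤ |s.im| →
      ‖W s / ((s - 1) * (s - ((ρ + 1 : ℝ) : ℂ)))‖ ≤ K / |s.im| ^ 2 := by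
    obtain ⟨N, hN⟩ := exists_nat_ge C₁
    obtain ⟨K, hK, hKb⟩ := PP_div_bound (N + 2) (1 - C₀) (ρ + 2) (by linarith)
    refine ⟨K * |K₂|, max y₀ 2, by positivity, fun s hs hsd hT => ?_⟩
    have hT2 : 2 ≤ |s.im| := (le_max_right _ _).trans hT
    have hT1 : y₀ ≤ |s.im| := (le_max_left _ _).trans hT
    have hsp : s ≠ ((ρ + 1 : ℝ) : ℂ) := by
      rintro rfl
      simp at hT2
      norm_num at hT2
    rw [hWeq s hs hsp, norm_mul]
    have b1 := hKb s hs hsd hT2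
    have b2 := hM2 (s - 1) (by simp; linarith) (by simpa using hT1)
    have im1 : (s - 1).im = s.im := by simp
    rw [im1] at b2
    have b3 : |s.im| ^ C₁ ≤ |s.im| ^ N := by
      rw [← Real.rpow_natCast]
      exact Real.rpow_le_rpow_of_exponent_le (by linarith) hN
    have b4 : ‖Dc (s - 1)‖ ≤ |K₂| * |s.im| ^ N :=
      b2.trans (mul_le_mul (le_abs_self _) b3 (by positivity) (abs_nonneg _))
    have hpos : 0 < |s.im| := by linarith
    calc _ ≤ K / |s.im| ^ (N + 2) * (|K₂| * |s.im| ^ N) := by gcongr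
      _ = K * |K₂| / |s.im| ^ 2 := by
        rw [pow_add]; field_simp
  have hf : ∀ s : ℂ, s.re = ρ + 2 → HasMellin (fun t => ((FF b t : ℝ) : ℂ)) s
      (W s / ((s - 1) * (s - ((ρ + 1 : ℝ) : ℂ)))) := by
    intro s hs
    refine ⟨FF_mellin_conv hb h1 (by linarith), ?_⟩
    have hsp : s ≠ ((ρ + 1 : ℝ) : ℂ) := by
      rintro rfl
      simp only [Complex.ofReal_re] at hs
      linarith
    have hs1 : s ≠ 1 := by
      rintro rfl
      simp only [Complex.one_re] at hs
      linarith
    rw [FF_mellin hb h1 (by linarith), hWeq s (by linarith) hsp, PP_eq (by linarith) hs1]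
    have : s - 1 ≠ 0 := sub_ne_zero.2 hs1
    field_simp
  have hfc : ∀ x : ℝ, 0 < x → ContinuousAt (fun t => ((FF b t : ℝ) : ℂ)) x := fun x hx =>
    Complex.continuous_ofReal.continuousAt.comp (FF_contAt hb h1 hx)
  obtain ⟨K, hK⟩ := asymp (fun t => ((FF b t : ℝ) : ℂ)) W (1 - C₀) (ρ + 2) (ρ + 1) (by linarith)
    (by linarith) (by linarith) (by linarith) hW hbd hf hfc
  refine ⟨K, fun x hx hx1 => ?_⟩
  have hρc : (ρ : ℂ) ≠ 0 := by exact_mod_cast hρ.ne'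
  have w1 : W ((ρ + 1 : ℝ) : ℂ) / (((ρ + 1 : ℝ) : ℂ) - 1) =
      ((A * Real.Gamma (ρ + 1) : ℝ) : ℂ) * riemannZeta ((ρ : ℂ) + 1) := by
    simp only [hWdef]
    rw [PP_eq (by simp; linarith) (by
      intro h
      have := congrArg Complex.re h
      simp at this
      linarith), Complex.Gamma_ofReal]
    push_cast
    simp only [add_sub_cancel_right, sub_self, zero_mul, add_zero]
    field_simp
  have w2 : W 1 / (1 - ((ρ + 1 : ℝ) : ℂ)) = Dc 0 := by
    simp only [hWdef]
    rw [PP_one, hDφ 0 (by simp; linarith) hρc.symm]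
    push_cast
    have : (1 : ℂ) - (ρ + 1) = -ρ := by ring
    rw [this, sub_self, zero_sub]
    field_simp
    ring
  have := hK x hx hx1
  rw [w1, w2] at this
  refine le_trans ?_ this
  refine le_trans (le_of_eq ?_) (Complex.abs_re_le_norm _)
  congr 1
  rw [Complex.sub_re, Complex.sub_re, Complex.re_mul_ofReal, Complex.re_mul_ofReal, Complex.re_ofReal_mul,
    Complex.ofReal_re, hMein]

lemma FF_large {b : ℕ → ℝ} {ρ C₀ h d K : ℝ} (hρ : 0 < ρ) (hC : 0 < C₀) (hh : 0 < h)
    (hG : ∀ x : ℝ, 0 < x → x < 1 →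
      |FF b x - h * x ^ (-(ρ + 1)) - d * x ^ (-1 : ℝ)| ≤ K * x ^ (-(1 - C₀))) (B : ℝ) :
    ∃ x : ℝ, 0 < x ∧ x < 1 ∧ B ≤ FF b x := by
  have t0 : ∀ e : ℝ, 0 < e → Tendsto (fun x : ℝ => x ^ e) (𝓝[>] 0) (𝓝 0) := by
    intro e he
    have := (Real.continuousAt_rpow_const 0 e (Or.inr he.le)).tendsto
    rw [Real.zero_rpow he.ne'] at this
    exact this.mono_left nhdsWithin_le_nhds
  have t1 : Tendsto (fun x : ℝ => h + d * x ^ ρ - K * x ^ (ρ + C₀) - B * x ^ (ρ + 1)) (𝓝[>] 0) (𝓝 h) := by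
    have := (((t0 ρ hρ).const_mul d).const_add h).sub ((t0 (ρ + C₀) (by linarith)).const_mul K) |>.sub
      ((t0 (ρ + 1) (by linarith)).const_mul B)
    simpa using this
  have e1 := t1.eventually (lt_mem_nhds hh)
  have e2 : ∀ᶠ x : ℝ in 𝓝[>] 0, x < 1 := nhdsWithin_le_nhds (gt_mem_nhds one_pos)
  have e3 : ∀ᶠ x : ℝ in 𝓝[>] 0, 0 < x := self_mem_nhdsWithin
  obtain ⟨x, hx, hx1, hx0⟩ := (e1.and (e2.and e3)).exists
  refine ⟨x, hx0, hx1, ?_⟩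
  have g := (abs_le.1 (hG x hx0 hx1)).1
  have r1 : x ^ (-1 : ℝ) = x ^ (-(ρ + 1)) * x ^ ρ := by
    rw [← Real.rpow_add hx0]; congr 1; ring
  have r2 : x ^ (-(1 - C₀)) = x ^ (-(ρ + 1)) * x ^ (ρ + C₀) := by
    rw [← Real.rpow_add hx0]; congr 1; ring
  have r3 : 1 = x ^ (-(ρ + 1)) * x ^ (ρ + 1) := by
    rw [← Real.rpow_add hx0]; simp
  have hp : 0 < x ^ (-(ρ + 1)) := Real.rpow_pos_of_pos hx0 _
  rw [r1, r2] at g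
  have hm := mul_pos hp hx
  have : B = B * (x ^ (-(ρ + 1)) * x ^ (ρ + 1)) := by rw [← r3, mul_one]
  nlinarith

theorem statement4    (b : ℕ → ℝ) (hb : ∀ k, 0 ≤ b k) (ρ C₀ A C₁ : ℝ) (Dc : ℂ → ℂ)
    (h1 : M1 b ρ C₀ A Dc) (h2 : M2 C₀ C₁ Dc) :
    ∃ α : ℕ → ℝ,
      (∀ᶠ n : ℕ in atTop, 0 < α n ∧ Abf b (Real.exp (-α n)) = n ∧
        ∀ β : ℝ, 0 < β → Abf b (Real.exp (-β)) = n → β = α n) ∧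
      Tendsto α atTop (𝓝 0) ∧
      (fun n : ℕ => α n - (aM ρ A n + (Dc 0).re / ((ρ + 1) * n)))
        =O[atTop] fun n : ℕ => (n : ℝ) ^ (-1 - min (C₀ / (ρ + 1)) (ρ / (ρ + 1))) := by
  obtain ⟨K, hK⟩ := FF_asymp hb h1 h2
  have hρ := h1.1
  have hC := h1.2.1
  have hA := h1.2.2.2.1
  have hh := hMein_pos hρ hA
  classical
  set α : ℕ → ℝ := fun n => if h : ∃ x : ℝ, 0 < x ∧ FF b x = n then h.choose else 0 with hα
  have hsol : ∀ᶠ n : ℕ in atTop, 0 < α n ∧ FF b (α n) = n := by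
    obtain ⟨N, hN⟩ := exists_nat_ge (FF b 1)
    filter_upwards [eventually_ge_atTop N] with n hn
    have hn' : FF b 1 ≤ n := hN.trans (by exact_mod_cast hn)
    obtain ⟨x, hx0, hx1, hx⟩ := FF_large hρ hC hh hK n
    have hc : ContinuousOn (FF b) (Set.Icc x 1) := fun y hy =>
      (FF_contAt hb h1 (hx0.trans_le hy.1)).continuousWithinAt
    obtain ⟨y, hy, hyn⟩ := intermediate_value_Icc' hx1.le hc ⟨hn', hx⟩
    have hex : ∃ x : ℝ, 0 < x ∧ FF b x = n := ⟨y, hx0.trans_le hy.1, hyn⟩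
    have : α n = hex.choose := by simp only [hα, dif_pos hex]
    rw [this]
    exact hex.choose_spec
  have hlim : Tendsto α atTop (𝓝 0) := by
    rw [Metric.tendsto_nhds]
    intro ε hε
    obtain ⟨N, hN⟩ := exists_nat_gt (FF b ε)
    filter_upwards [hsol, eventually_ge_atTop N] with n ⟨hn0, hn⟩ hnN
    rw [Real.dist_eq, sub_zero, abs_of_pos hn0]
    by_contra hcon
    have hle : FF b (α n) ≤ FF b ε := by
      rcases (not_lt.1 hcon).eq_or_lt with h | h
      · rw [h]
      · exact (FF_strictAnti hb h1 hε h).le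
    have : (N : ℝ) ≤ n := by exact_mod_cast hnN
    linarith
  refine ⟨α, ?_, hlim, ?_⟩
  · filter_upwards [hsol] with n ⟨hn0, hn⟩
    refine ⟨hn0, by rw [Abf_eq hb h1 hn0, hn], fun β hβ hβn => ?_⟩
    rw [Abf_eq hb h1 hβ] at hβn
    rcases lt_trichotomy β (α n) with h | h | h
    · have := FF_strictAnti hb h1 hβ h
      linarith
    · exact h
    · have := FF_strictAnti hb h1 hn0 h
      linarith
  · exact inversion (FF b) (hMein ρ A) ρ C₀ (Dc 0).re K hh hρ hC hK α hsol hlim
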